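/- Let A = kQ/I be a (locally) gentle algebra with an infinite maximal path γ. Then the left annihilator ann_A(J_γ) is a two-sided ideal of A, and A = A' ⊕ ann_A(J_γ), where A' = kQ'/(I ∩ kQ') is the locally gentle subalgebra of A on the minimal subquiver Q' of Q containing γ (the arrows α with γ_α = γ and their endpoints), and A' has γ as its unique maximal path. -/

import Mathlib

/- Common framework for (locally) gentle algebras -/

noncomputable section
open scoped BigOperators
open CategoryTheory

namespace LocGentle

/-- A finite connected quiver with at least one vertex and one arrow. -/
structure Quiv where
  V : Type
  Arr : Type
  [fintypeV : Fintype V]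
  [fintypeA : Fintype Arr]
  [decEqV : DecidableEq V]
  [decEqA : DecidableEq Arr]
  src : Arr → V
  tgt : Arr → V
  [nonemptyV : Nonempty V]
  [nonemptyA : Nonempty Arr]
  connected : (SimpleGraph.fromRel (fun v w => ∃ a, src a = v ∧ tgt a = w)).Connected

attribute [instance] Quiv.fintypeV Quiv.fintypeA Quiv.decEqV Quiv.decEqA
  Quiv.nonemptyV Quiv.nonemptyA

variable (Q : Quiv)

/-- in-degree of a vertex -/
def indeg (v : Q.V) : ℕ := (Finset.univ.filter (fun a => Q.tgt a = v)).card

/-- out-degree of a vertex -/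
def outdeg (v : Q.V) : ℕ := (Finset.univ.filter (fun a => Q.src a = v)).card

/-- a list of arrows is composable (forms a path) -/
def Composable (l : List Q.Arr) : Prop := l.Chain' (fun a b => Q.tgt a = Q.src b)

variable {Q}

/-- source vertex of a nonempty word -/
def wSrc? (l : List Q.Arr) : Option Q.V := l.head?.map Q.src

/-- target vertex of a nonempty word -/
def wTgt? (l : List Q.Arr) : Option Q.V := l.getLast?.map Q.tgt

/-- target of a word, with a default value (used for stationary paths) -/
def wTgtD (l : List Q.Arr) (v : Q.V) : Q.V := (l.getLast?.map Q.tgt).getD v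

/-- last arrow of a word, with a (junk) default -/
def wLast (l : List Q.Arr) : Q.Arr := l.getLast?.getD (Classical.arbitrary _)

variable (rel : Q.Arr → Q.Arr → Prop)

/-- A word is allowed (is a basis path of `A = kQ/I`) if consecutive arrows are
composable and no consecutive pair lies in the relation set generating `I`. -/
def AllowedWord (l : List Q.Arr) : Prop :=
  l.Chain' (fun a b => Q.tgt a = Q.src b ∧ ¬ rel a b)

/-- right maximal paths (of positive length) -/
def RightMaxWord (l : List Q.Arr) : Prop :=
  l ≠ [] ∧ AllowedWord rel l ∧ ∀ a : Q.Arr, ¬ AllowedWord rel (l ++ [a])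

/-- left maximal paths (of positive length) -/
def LeftMaxWord (l : List Q.Arr) : Prop :=
  l ≠ [] ∧ AllowedWord rel l ∧ ∀ a : Q.Arr, ¬ AllowedWord rel (a :: l)

/-- finite maximal paths -/
def FiniteMaxWord (l : List Q.Arr) : Prop := RightMaxWord rel l ∧ LeftMaxWord rel l

/-- a word is primitive if it is not a proper power -/
def PrimitiveWord (l : List Q.Arr) : Prop :=
  ∀ (l' : List Q.Arr) (n : ℕ), 2 ≤ n → l ≠ (List.replicate n l').flatten

/-- a primitive cycle `c` with `c² ∉ I`; these represent the infinite maximal paths `c^∞`. -/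
def PrimCycleSq (c : List Q.Arr) : Prop :=
  c ≠ [] ∧ AllowedWord rel (c ++ c) ∧ wTgt? c = wSrc? c ∧ PrimitiveWord c

/-- the maximal path `γ_α` containing `α` is infinite -/
def InfThrough (a : Q.Arr) : Prop := ∃ c, PrimCycleSq rel c ∧ a ∈ c

/-- the maximal path `γ_α` containing `α` is finite -/
def FinThrough (a : Q.Arr) : Prop := ∃ l, FiniteMaxWord rel l ∧ a ∈ l

/-- the rotation of the cycle `c` starting at the arrow `a`; when `a ∈ c` and `c` has no
duplicates this is the primitive cycle `γ_r(a)`. -/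
def rotTo (c : List Q.Arr) (a : Q.Arr) : List Q.Arr :=
  c.dropWhile (fun b => b != a) ++ c.takeWhile (fun b => b != a)

/-- the relation set of the Koszul dual `A#`; its allowed words are the forbidden paths of `A`. -/
def dualRel : Q.Arr → Q.Arr → Prop := fun a b => Q.tgt a = Q.src b ∧ ¬ rel a b

/-- a forbidden path of `A`, i.e. a path of the Koszul dual `A#` -/
def ForbiddenWord (l : List Q.Arr) : Prop := AllowedWord (dualRel rel) l

variable (Q)

/-- The defining conditions (i)-(iv) of a (locally) gentle algebra, in terms of the set of
length-two relations generating the ideal `I`: an algebra satisfying them is gentle if it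
is finite dimensional and locally gentle otherwise. -/
structure IsGentleRel : Prop where
  indeg_le : ∀ v : Q.V, indeg Q v ≤ 2
  outdeg_le : ∀ v : Q.V, outdeg Q v ≤ 2
  rel_comp : ∀ a b : Q.Arr, rel a b → Q.tgt a = Q.src b
  cond_ii : ∀ a b b' : Q.Arr, b ≠ b' → Q.tgt b = Q.src a → Q.tgt b' = Q.src a →
    Xor' (rel b a) (rel b' a)
  cond_iii : ∀ a b b' : Q.Arr, b ≠ b' → Q.tgt a = Q.src b → Q.tgt a = Q.src b' →
    Xor' (rel a b) (rel a b')

/-- `Q` is (as a quiver) the extended Dynkin quiver `Ã_n` (for `n = |Q₀| - 1`):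
every vertex has in-degree and out-degree one. -/
def IsAtilde : Prop := ∀ v : Q.V, indeg Q v = 1 ∧ outdeg Q v = 1

/-- paths of `Q`, including the stationary paths (`w = []`) at each vertex -/
structure Pth where
  s : Q.V
  w : List Q.Arr
  hs : ∀ a ∈ w.head?, Q.src a = s
  hc : Composable Q w

variable {Q}

/-- target of a path -/
def Pth.t (p : Pth Q) : Q.V := wTgtD p.w p.s

/-- length of a path -/
def Pth.len (p : Pth Q) : ℕ := p.w.length

/-- a basis path of `A = kQ/I` -/
def Pth.Allowed (p : Pth Q) : Prop := AllowedWord rel p.w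

end LocGentle
namespace LocGentle

variable (k : Type) [Field k] (Q : Quiv) (rel : Q.Arr → Q.Arr → Prop)

/-- The defining relations presenting `A = kQ/I` as a quotient of the free algebra on
the stationary paths (vertices) and arrows: the path algebra relations together with
the relations `αβ = 0` for the length-two paths `αβ` generating `I`. -/
inductive GARel : FreeAlgebra k (Q.V ⊕ Q.Arr) → FreeAlgebra k (Q.V ⊕ Q.Arr) → Prop
  | idem (v : Q.V) : GARel (FreeAlgebra.ι k (Sum.inl v) * FreeAlgebra.ι k (Sum.inl v))
      (FreeAlgebra.ι k (Sum.inl v))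
  | orth (v w : Q.V) : v ≠ w → GARel (FreeAlgebra.ι k (Sum.inl v) * FreeAlgebra.ι k (Sum.inl w)) 0
  | unit : GARel (∑ v : Q.V, FreeAlgebra.ι k (Sum.inl v)) 1
  | src_mul (a : Q.Arr) : GARel (FreeAlgebra.ι k (Sum.inl (Q.src a)) * FreeAlgebra.ι k (Sum.inr a))
      (FreeAlgebra.ι k (Sum.inr a))
  | mul_tgt (a : Q.Arr) : GARel (FreeAlgebra.ι k (Sum.inr a) * FreeAlgebra.ι k (Sum.inl (Q.tgt a)))
      (FreeAlgebra.ι k (Sum.inr a))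
  | src_zero (v : Q.V) (a : Q.Arr) : v ≠ Q.src a →
      GARel (FreeAlgebra.ι k (Sum.inl v) * FreeAlgebra.ι k (Sum.inr a)) 0
  | tgt_zero (v : Q.V) (a : Q.Arr) : v ≠ Q.tgt a →
      GARel (FreeAlgebra.ι k (Sum.inr a) * FreeAlgebra.ι k (Sum.inl v)) 0
  | rel_zero (a b : Q.Arr) : rel a b →
      GARel (FreeAlgebra.ι k (Sum.inr a) * FreeAlgebra.ι k (Sum.inr b)) 0

/-- The (locally) gentle algebra `A = kQ/I`. -/
abbrev GA := RingQuot (GARel k Q rel)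

/-- the image in `A` of the stationary path at `v` -/
def vtx (v : Q.V) : GA k Q rel := RingQuot.mkAlgHom k _ (FreeAlgebra.ι k (Sum.inl v))

/-- the image in `A` of the arrow `a` -/
def arr (a : Q.Arr) : GA k Q rel := RingQuot.mkAlgHom k _ (FreeAlgebra.ι k (Sum.inr a))

/-- the image in `A` of the word `l` (the product of its arrows) -/
def wordEl (l : List Q.Arr) : GA k Q rel := (l.map (arr k Q rel)).prod

variable {Q}

/-- the image in `A` of a path (a stationary path maps to the corresponding idempotent) -/
def Pth.el (p : Pth Q) : GA k Q rel := vtx k Q rel p.s * wordEl k Q rel p.w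

variable (Q)

/-- the `n`-th graded component `A_n` of `A`, spanned by the images of paths of length `n` -/
def deg (n : ℕ) : Submodule k (GA k Q rel) :=
  Submodule.span k {x | ∃ p : Pth Q, p.Allowed rel ∧ p.len = n ∧ x = p.el k rel}

/-- the augmentation ideal `A₊` (as a `k`-submodule), spanned by paths of positive length -/
def degPlus : Submodule k (GA k Q rel) :=
  Submodule.span k {x | ∃ p : Pth Q, p.Allowed rel ∧ 1 ≤ p.len ∧ x = p.el k rel}

/-- the Hilbert series of `A` (with integer coefficients) -/
def hilb : PowerSeries ℤ :=
  PowerSeries.mk fun n => (Module.finrank k (deg k Q rel n) : ℤ)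

/-- the Hilbert series of `A` (with rational coefficients) -/
def hilbQ : PowerSeries ℚ :=
  PowerSeries.mk fun n => (Module.finrank k (deg k Q rel n) : ℚ)

/-- the number `k_n` of finite maximal paths of length at least `n` -/
def numFMP (n : ℕ) : ℕ := {l : List Q.Arr | FiniteMaxWord rel l ∧ n ≤ l.length}.ncard

/-- the Gelfand-Kirillov dimension of `A`:
`limsup_n log (dim_k A_{≤ n}) / log n`. -/
def GKdim : ℝ :=
  Filter.limsup (fun n : ℕ =>
      Real.log (Module.finrank k ↥(⨆ i ∈ Finset.range (n + 1), deg k Q rel i)) / Real.log n)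
    Filter.atTop

/-- the central element `m_γ` attached to the infinite maximal path `γ = c^∞`:
the sum over the arrows `α` of `c` of the primitive cycle `γ_r(α)` starting at `α`. -/
def mEl (c : List Q.Arr) : GA k Q rel := (c.map fun a => wordEl k Q rel (rotTo c a)).sum

/-- evaluation of a polynomial at `x ∈ A`; `polyEval k Q rel p x` is `p(x)`. -/
def polyEval (p : Polynomial k) (x : GA k Q rel) : GA k Q rel :=
  Polynomial.eval₂ (algebraMap k (GA k Q rel)) x p

end LocGentle
namespace LocGentle

variable (k : Type) [Field k] (Q : Quiv) (rel : Q.Arr → Q.Arr → Prop)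

/-! ### Two-sided ideals and primes -/

/-- a prime (two-sided) ideal -/
def IsPrimeTI (P : TwoSidedIdeal (GA k Q rel)) : Prop :=
  P ≠ ⊤ ∧ ∀ x y : GA k Q rel, (∀ a : GA k Q rel, x * a * y ∈ P) → x ∈ P ∨ y ∈ P

/-- the maximal ideal `𝔪_v` of `A` which does not contain `ε_v`: it is generated by the
stationary paths at the other vertices together with all loops at `v`. -/
def mIdeal (v : Q.V) : TwoSidedIdeal (GA k Q rel) :=
  TwoSidedIdeal.span
    ({x | ∃ w : Q.V, w ≠ v ∧ x = vtx k Q rel w} ∪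
     {x | ∃ a : Q.Arr, Q.src a = v ∧ Q.tgt a = v ∧ x = arr k Q rel a})

/-- the ideal `J_γ` corresponding to the infinite maximal path `γ = c^∞`, generated by
all arrows lying on `γ` -/
def Jgamma (c : List Q.Arr) : TwoSidedIdeal (GA k Q rel) :=
  TwoSidedIdeal.span {x | ∃ a ∈ c, x = arr k Q rel a}

/-- the left annihilator of `J_γ` -/
def annJ (c : List Q.Arr) : Set (GA k Q rel) :=
  {x | ∀ y ∈ Jgamma k Q rel c, x * y = 0}

/-! ### The simple modules `S(v)`, and `Ext` groups -/

/-- the algebra map `A → k` corresponding to the vertex `v` (projection onto the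
coefficient of `ε_v`) -/
def vtxHomAux (v : Q.V) : FreeAlgebra k (Q.V ⊕ Q.Arr) →ₐ[k] k :=
  FreeAlgebra.lift k (Sum.elim (fun w => if w = v then (1 : k) else 0) (fun _ => 0))

theorem vtxHomAux_rel (v : Q.V) : ∀ ⦃x y⦄, GARel k Q rel x y →
    vtxHomAux k Q v x = vtxHomAux k Q v y := by
  intro x y h
  cases h with
  | idem w =>
      simp only [vtxHomAux, map_mul, FreeAlgebra.lift_ι_apply, Sum.elim_inl]
      split_ifs <;> simp
  | orth w w' hne =>
      simp only [vtxHomAux, map_mul, FreeAlgebra.lift_ι_apply, Sum.elim_inl, map_zero]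
      split_ifs with h1 h2 <;> first | (exact absurd (h1.trans h2.symm) hne) | simp
  | unit =>
      simp only [vtxHomAux, map_sum, FreeAlgebra.lift_ι_apply, Sum.elim_inl, map_one]
      simp [Finset.sum_ite_eq' Finset.univ v (fun _ => (1:k))]
  | src_mul a =>
      simp [vtxHomAux, map_mul, FreeAlgebra.lift_ι_apply]
  | mul_tgt a =>
      simp [vtxHomAux, map_mul, FreeAlgebra.lift_ι_apply]
  | src_zero w a hw =>
      simp [vtxHomAux, map_mul, FreeAlgebra.lift_ι_apply]
  | tgt_zero w a hw =>
      simp [vtxHomAux, map_mul, FreeAlgebra.lift_ι_apply]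
  | rel_zero a b hab =>
      simp [vtxHomAux, map_mul, FreeAlgebra.lift_ι_apply]

/-- the ring map `A → k` corresponding to the vertex `v` -/
def vtxHom (v : Q.V) : GA k Q rel →+* k :=
  RingQuot.lift ⟨(vtxHomAux k Q v).toRingHom, fun _ _ h => vtxHomAux_rel k Q rel v h⟩

/-- the ring map `A → k^{Q₀}` with kernel `A₊` -/
def SHom : GA k Q rel →+* (Q.V → k) := Pi.ringHom fun v => vtxHom k Q rel v

/-- the graded simple right `A`-module `S(v)` at the vertex `v` -/
def SvModR (v : Q.V) : ModuleCat (GA k Q rel)ᵐᵒᵖ :=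
  @ModuleCat.of _ _ k _
    (Module.compHom k ((vtxHom k Q rel v).fromOpposite (fun _ _ => mul_comm _ _)))

/-- the graded simple left `A`-module `S(v)` at the vertex `v` -/
def SvModL (v : Q.V) : ModuleCat (GA k Q rel) :=
  @ModuleCat.of _ _ k _ (Module.compHom k (vtxHom k Q rel v))

/-- `S = A/A₊ ≅ ⊕_v S(v)` as a right `A`-module -/
def SModR : ModuleCat (GA k Q rel)ᵐᵒᵖ :=
  @ModuleCat.of _ _ (Q.V → k) _
    (Module.compHom _ ((SHom k Q rel).fromOpposite (fun _ _ => mul_comm _ _)))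

/-- `S = A/A₊` as a left `A`-module -/
def SModL : ModuleCat (GA k Q rel) :=
  @ModuleCat.of _ _ (Q.V → k) _ (Module.compHom _ (SHom k Q rel))

/-- `A` as a right module over itself -/
def AModR : ModuleCat (GA k Q rel)ᵐᵒᵖ := ModuleCat.of _ (GA k Q rel)

/-- `A` as a left module over itself -/
def AModL : ModuleCat (GA k Q rel) := ModuleCat.of _ (GA k Q rel)

/-- nonvanishing of `Ext^i(M, N)` for modules over a ring `R` -/
def extNZ {R : Type} [Ring R] (i : ℕ) (M N : ModuleCat R) : Prop :=
  ¬ Subsingleton (((Ext ℤ (ModuleCat R) i).obj (Opposite.op M)).obj N)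

/-- nonvanishing of `Ext^i_A(S(v), A)` in right `A`-modules.  (For the Noetherian graded
algebra `A` with the finitely generated modules `S(v)` and `A` this agrees with the graded
`Ext`-group, summed over all shifts, used in the paper.) -/
def extSvNZ (i : ℕ) (v : Q.V) : Prop := extNZ i (SvModR k Q rel v) (AModR k Q rel)

/-- nonvanishing of `Ext^i_A(S, A)` in right `A`-modules -/
def extSNZ (i : ℕ) : Prop := extNZ i (SModR k Q rel) (AModR k Q rel)

/-- the depth of `A`: `min { i : Ext^i_A(S, A) ≠ 0 }` -/
def depth : ℕ∞ := sInf {n : ℕ∞ | ∃ i : ℕ, n = i ∧ extSNZ k Q rel i}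

/-- the right self-injective dimension of `A`:
`sup { i : Ext^i(M, A) ≠ 0 for some right module M }` -/
def rInjDim : ℕ∞ :=
  sSup {n : ℕ∞ | ∃ (i : ℕ) (M : ModuleCat.{0} (GA k Q rel)ᵐᵒᵖ), n = i ∧ extNZ i M (AModR k Q rel)}

/-- the left self-injective dimension of `A` -/
def lInjDim : ℕ∞ :=
  sSup {n : ℕ∞ | ∃ (i : ℕ) (M : ModuleCat.{0} (GA k Q rel)), n = i ∧ extNZ i M (AModL k Q rel)}

/-- the right global dimension of `A`: `sup { i : Ext^i(M, N) ≠ 0 }` over right modules -/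
def rGlDim : ℕ∞ :=
  sSup {n : ℕ∞ | ∃ (i : ℕ) (M N : ModuleCat.{0} (GA k Q rel)ᵐᵒᵖ), n = i ∧ extNZ i M N}

/-- the left global dimension of `A` -/
def lGlDim : ℕ∞ :=
  sSup {n : ℕ∞ | ∃ (i : ℕ) (M N : ModuleCat.{0} (GA k Q rel)), n = i ∧ extNZ i M N}

end LocGentle
namespace LocGentle

/-- `b` may follow `a` in an allowed word. -/
def Follows {Q : Quiv} (rel : Q.Arr → Q.Arr → Prop) (a b : Q.Arr) : Prop :=
  Q.tgt a = Q.src b ∧ ¬ rel a b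

section Combinatorics

variable {Q : Quiv} {rel : Q.Arr → Q.Arr → Prop}

theorem allowedWord_iff {l : List Q.Arr} : AllowedWord rel l ↔ l.IsChain (Follows rel) := Iff.rfl

theorem IsGentleRel.follows_right_unique (h : IsGentleRel Q rel) {a b b' : Q.Arr}
    (hb : Follows rel a b) (hb' : Follows rel a b') : b = b' := by
  by_contra hne
  rcases h.cond_iii a b b' hne hb.1 hb'.1 with h1 | h1
  · exact hb.2 h1.1
  · exact hb'.2 h1.1

theorem IsGentleRel.follows_left_unique (h : IsGentleRel Q rel) {a a' b : Q.Arr}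
    (ha : Follows rel a b) (ha' : Follows rel a' b) : a = a' := by
  by_contra hne
  rcases h.cond_ii b a a' hne ha.1 ha'.1 with h1 | h1
  · exact ha.2 h1.1
  · exact ha'.2 h1.1

open Classical in
/-- The arrow following `a` in an allowed word, if there is one. -/
def nextArr (rel : Q.Arr → Q.Arr → Prop) (a : Q.Arr) : Q.Arr :=
  if h : ∃ b, Follows rel a b then h.choose else a

theorem IsGentleRel.nextArr_eq (h : IsGentleRel Q rel) {a b : Q.Arr} (hb : Follows rel a b) :
    nextArr rel a = b := by
  have hex : ∃ b, Follows rel a b := ⟨b, hb⟩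
  rw [nextArr, dif_pos hex]
  exact h.follows_right_unique hex.choose_spec hb

theorem PrimCycleSq.exists_follows {c : List Q.Arr} (hc : PrimCycleSq rel c) {a : Q.Arr}
    (ha : a ∈ c) : ∃ b ∈ c, Follows rel a b := by
  obtain ⟨i, hi, rfl⟩ := List.mem_iff_getElem.1 ha
  have hch := List.isChain_iff_getElem.1 (allowedWord_iff.1 hc.2.1) i (by simp; omega)
  rw [List.getElem_append_left hi] at hch
  refine ⟨_, ?_, hch⟩
  have hi' : i + 1 < (c ++ c).length := by simp; omega
  exact (List.mem_append.1 (List.getElem_mem hi')).elim id id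

theorem PrimCycleSq.exists_follows_left {c : List Q.Arr} (hc : PrimCycleSq rel c) {b : Q.Arr}
    (hb : b ∈ c) : ∃ a ∈ c, Follows rel a b := by
  obtain ⟨i, hi, rfl⟩ := List.mem_iff_getElem.1 hb
  have hch := List.isChain_iff_getElem.1 (allowedWord_iff.1 hc.2.1) (i + c.length - 1)
    (by simp; omega)
  have hidx : (c ++ c)[i + c.length - 1 + 1]'(by simp; omega) = (c)[i] := by
    rw [List.getElem_append_right (by omega)]
    congr
    omega
  rw [hidx] at hch
  refine ⟨_, ?_, hch⟩
  have hi' : i + c.length - 1 < (c ++ c).length := by simp; omega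
  exact (List.mem_append.1 (List.getElem_mem hi')).elim id id

theorem PrimCycleSq.mem_of_follows (h : IsGentleRel Q rel) {c : List Q.Arr}
    (hc : PrimCycleSq rel c) {a b : Q.Arr} (hab : Follows rel a b) (ha : a ∈ c) : b ∈ c := by
  obtain ⟨b', hb', hf⟩ := hc.exists_follows ha
  rwa [h.follows_right_unique hab hf]

theorem PrimCycleSq.mem_of_follows_left (h : IsGentleRel Q rel) {c : List Q.Arr}
    (hc : PrimCycleSq rel c) {a b : Q.Arr} (hab : Follows rel a b) (hb : b ∈ c) : a ∈ c := by
  obtain ⟨a', ha', hf⟩ := hc.exists_follows_left hb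
  rwa [h.follows_left_unique hab hf]

theorem PrimCycleSq.follows_nextArr (h : IsGentleRel Q rel) {c : List Q.Arr}
    (hc : PrimCycleSq rel c) {a : Q.Arr} (ha : a ∈ c) : Follows rel a (nextArr rel a) := by
  obtain ⟨b, -, hf⟩ := hc.exists_follows ha
  rwa [h.nextArr_eq hf]

theorem PrimCycleSq.nextArr_mem (h : IsGentleRel Q rel) {c : List Q.Arr}
    (hc : PrimCycleSq rel c) {a : Q.Arr} (ha : a ∈ c) : nextArr rel a ∈ c :=
  hc.mem_of_follows h (hc.follows_nextArr h ha) ha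

theorem IsGentleRel.eq_iterate (h : IsGentleRel Q rel) {a : Q.Arr} {l : List Q.Arr}
    (hl : AllowedWord rel (a :: l)) : a :: l = List.iterate (nextArr rel) a (l.length + 1) := by
  induction l generalizing a with
  | nil => simp
  | cons b l ih =>
    obtain ⟨hab, hl⟩ := List.isChain_cons_cons.1 (allowedWord_iff.1 hl)
    rw [List.length_cons, List.iterate, h.nextArr_eq hab, ← ih hl]

theorem PrimCycleSq.exists_eq_iterate (h : IsGentleRel Q rel) {c : List Q.Arr}
    (hc : PrimCycleSq rel c) : ∃ a ∈ c,
      c = List.iterate (nextArr rel) a (Function.minimalPeriod (nextArr rel) a) := by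
  obtain ⟨hne, hal, -, hprim⟩ := hc
  obtain ⟨a, l, rfl⟩ := List.exists_cons_of_ne_nil hne
  refine ⟨a, by simp, ?_⟩
  set f := nextArr rel
  have hl := h.eq_iterate (allowedWord_iff.1 hal).left_of_append
  have hll := h.eq_iterate (l := l ++ a :: l) hal
  have hper : Function.IsPeriodicPt f (l.length + 1) a := by
    have := congrArg (fun w => w[l.length + 1]?) hll
    simp only [← List.cons_append] at this
    rw [List.getElem?_append_right (by simp)] at this
    rw [List.getElem?_eq_getElem (by simp), List.getElem?_eq_getElem (by simp)] at this
    simp only [List.getElem_iterate, Option.some.injEq] at this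
    simpa [Function.IsPeriodicPt, Function.IsFixedPt] using this.symm
  obtain ⟨q, hq⟩ := hper.minimalPeriod_dvd
  have hflat : ∀ q, List.iterate f a (Function.minimalPeriod f a * q) =
      (List.replicate q (List.iterate f a (Function.minimalPeriod f a))).flatten := by
    intro q
    induction q with
    | zero => simp
    | succ q ih =>
      rw [Nat.mul_succ, Nat.add_comm, List.iterate_add, Function.iterate_minimalPeriod, ih,
        List.replicate_succ, List.flatten_cons]
  have hq2 : ¬ 2 ≤ q := fun h2 => hprim _ q h2 (by rw [hl, hq, hflat])
  have hq1 : q = 1 := by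
    rcases Nat.eq_zero_or_pos q with h0 | h0
    · simp [h0] at hq
    · omega
  rw [hl, hq, hq1, mul_one]

theorem PrimCycleSq.eq_rotate (h : IsGentleRel Q rel) {c l : List Q.Arr}
    (hc : PrimCycleSq rel c) (hl : PrimCycleSq rel l) (hlc : ∀ a ∈ l, a ∈ c) :
    ∃ n : ℕ, l = c.rotate n := by
  obtain ⟨a, -, hca⟩ := hc.exists_eq_iterate h
  obtain ⟨b, hb, hlb⟩ := hl.exists_eq_iterate h
  set f := nextArr rel
  have hbc := hlc b hb
  rw [hca] at hbc
  obtain ⟨i, hi, rfl⟩ := List.mem_iff_getElem.1 hbc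
  rw [List.length_iterate] at hi
  have hper : a ∈ Function.periodicPts f :=
    Function.minimalPeriod_pos_iff_mem_periodicPts.1 (by omega)
  refine ⟨i, ?_⟩
  rw [List.getElem_iterate, Function.minimalPeriod_apply_iterate hper] at hlb
  rw [hlb, hca]
  refine List.ext_getElem (by simp) fun j h1 h2 => ?_
  rw [List.getElem_rotate, List.getElem_iterate, List.getElem_iterate, List.length_iterate,
    Function.iterate_mod_minimalPeriod_eq, Function.iterate_add_apply]

theorem PrimCycleSq.not_finiteMaxWord (h : IsGentleRel Q rel) {c : List Q.Arr}
    (hc : PrimCycleSq rel c) {l : List Q.Arr} (hl : FiniteMaxWord rel l) :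
    ∃ a ∈ l, a ∉ c := by
  by_contra! hcon
  obtain ⟨⟨hne, hal, hmax⟩, -⟩ := hl
  refine hmax (nextArr rel (l.getLast hne)) (List.IsChain.append hal (by simp) ?_)
  intro x hx y hy
  rw [List.getLast?_eq_some_getLast hne] at hx
  obtain rfl : l.getLast hne = x := by simpa using hx
  obtain rfl : nextArr rel (l.getLast hne) = y := by simpa using hy
  exact hc.follows_nextArr h (hcon _ (List.getLast_mem hne))

end Combinatorics

section Algebra

variable {k : Type} [Field k] {Q : Quiv} {rel : Q.Arr → Q.Arr → Prop}

theorem vtx_mul_self (v : Q.V) : vtx k Q rel v * vtx k Q rel v = vtx k Q rel v := by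
  simpa only [vtx, map_mul, map_zero] using RingQuot.mkAlgHom_rel k (GARel.idem (rel := rel) v)

theorem vtx_mul_of_ne {v w : Q.V} (h : v ≠ w) : vtx k Q rel v * vtx k Q rel w = 0 := by
  simpa only [vtx, map_mul, map_zero] using RingQuot.mkAlgHom_rel k (GARel.orth (rel := rel) v w h)

theorem sum_vtx : ∑ v : Q.V, vtx k Q rel v = 1 := by
  simpa only [vtx, map_sum, map_one] using RingQuot.mkAlgHom_rel k (GARel.unit (k := k) (rel := rel))

theorem vtx_src_mul_arr (a : Q.Arr) :
    vtx k Q rel (Q.src a) * arr k Q rel a = arr k Q rel a := by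
  simpa only [vtx, arr, map_mul, map_zero] using RingQuot.mkAlgHom_rel k (GARel.src_mul (rel := rel) a)

theorem arr_mul_vtx_tgt (a : Q.Arr) :
    arr k Q rel a * vtx k Q rel (Q.tgt a) = arr k Q rel a := by
  simpa only [vtx, arr, map_mul, map_zero] using RingQuot.mkAlgHom_rel k (GARel.mul_tgt (rel := rel) a)

theorem vtx_mul_arr_of_ne {v : Q.V} {a : Q.Arr} (h : v ≠ Q.src a) :
    vtx k Q rel v * arr k Q rel a = 0 := by
  simpa only [vtx, arr, map_mul, map_zero] using RingQuot.mkAlgHom_rel k (GARel.src_zero (rel := rel) v a h)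

theorem arr_mul_vtx_of_ne {v : Q.V} {a : Q.Arr} (h : v ≠ Q.tgt a) :
    arr k Q rel a * vtx k Q rel v = 0 := by
  simpa only [vtx, arr, map_mul, map_zero] using RingQuot.mkAlgHom_rel k (GARel.tgt_zero (rel := rel) v a h)

theorem arr_mul_arr_of_not_follows {a b : Q.Arr} (h : ¬ Follows rel a b) :
    arr k Q rel a * arr k Q rel b = 0 := by
  by_cases hab : Q.tgt a = Q.src b
  · have hr : rel a b := by
      by_contra hr
      exact h ⟨hab, hr⟩
    simpa only [arr, map_mul, map_zero] using RingQuot.mkAlgHom_rel k (GARel.rel_zero a b hr)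
  · rw [← arr_mul_vtx_tgt a, mul_assoc, vtx_mul_arr_of_ne hab, mul_zero]

theorem wordEl_cons (a : Q.Arr) (l : List Q.Arr) :
    wordEl k Q rel (a :: l) = arr k Q rel a * wordEl k Q rel l := by
  simp [wordEl]

theorem wordEl_concat (l : List Q.Arr) (a : Q.Arr) :
    wordEl k Q rel (l ++ [a]) = wordEl k Q rel l * arr k Q rel a := by
  simp [wordEl]

theorem mul_mem_of_generators_left {S : Submodule k (GA k Q rel)}
    (hv : ∀ v, ∀ x ∈ S, vtx k Q rel v * x ∈ S) (ha : ∀ a, ∀ x ∈ S, arr k Q rel a * x ∈ S)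
    (z : GA k Q rel) {x : GA k Q rel} (hx : x ∈ S) : z * x ∈ S := by
  obtain ⟨z, rfl⟩ := RingQuot.mkAlgHom_surjective k (GARel k Q rel) z
  induction z using FreeAlgebra.induction generalizing x with
  | grade0 r =>
    rw [AlgHom.commutes, ← Algebra.smul_def]
    exact S.smul_mem r hx
  | grade1 g => exact g.casesOn (fun v => hv v x hx) (fun a => ha a x hx)
  | mul y z hy hz =>
    rw [map_mul, mul_assoc]
    exact hy (hz hx)
  | add y z hy hz =>
    rw [map_add, add_mul]
    exact S.add_mem (hy hx) (hz hx)

theorem mul_mem_of_generators_right {S : Submodule k (GA k Q rel)}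
    (hv : ∀ v, ∀ x ∈ S, x * vtx k Q rel v ∈ S) (ha : ∀ a, ∀ x ∈ S, x * arr k Q rel a ∈ S)
    (z : GA k Q rel) {x : GA k Q rel} (hx : x ∈ S) : x * z ∈ S := by
  obtain ⟨z, rfl⟩ := RingQuot.mkAlgHom_surjective k (GARel k Q rel) z
  induction z using FreeAlgebra.induction generalizing x with
  | grade0 r =>
    rw [AlgHom.commutes, ← Algebra.commutes, ← Algebra.smul_def]
    exact S.smul_mem r hx
  | grade1 g => exact g.casesOn (fun v => hv v x hx) (fun a => ha a x hx)
  | mul y z hy hz =>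
    rw [map_mul, ← mul_assoc]
    exact hz (hy hx)
  | add y z hy hz =>
    rw [map_add, mul_add]
    exact S.add_mem (hy hx) (hz hx)

theorem mul_mem_of_mem_span {R : Type*} [CommSemiring R] {B : Type*} [Semiring B] [Algebra R B]
    {X : Set B} {S : Submodule R B} {z : B} (h : ∀ x ∈ X, z * x ∈ S) {x : B}
    (hx : x ∈ Submodule.span R X) : z * x ∈ S := by
  have : Submodule.span R X ≤ S.comap (LinearMap.mulLeft R z) := Submodule.span_le.2 h
  exact this hx

theorem mem_mul_of_mem_span {R : Type*} [CommSemiring R] {B : Type*} [Semiring B] [Algebra R B]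
    {X : Set B} {S : Submodule R B} {z : B} (h : ∀ x ∈ X, x * z ∈ S) {x : B}
    (hx : x ∈ Submodule.span R X) : x * z ∈ S := by
  have : Submodule.span R X ≤ S.comap (LinearMap.mulRight R z) := Submodule.span_le.2 h
  exact this hx

variable (k rel) in
/-- The images of the nonempty allowed words in the arrows of `c`. -/
def cycleWords (c : List Q.Arr) : Set (GA k Q rel) :=
  {x | ∃ l : List Q.Arr, l ≠ [] ∧ AllowedWord rel l ∧ (∀ a ∈ l, a ∈ c) ∧ x = wordEl k Q rel l}

variable (k rel) in
/-- The stationary paths at the vertices of `c`. -/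
def cycleVtxs (c : List Q.Arr) : Set (GA k Q rel) :=
  {x | ∃ a ∈ c, x = vtx k Q rel (Q.src a)}

theorem vtx_mul_cycleWords (c : List Q.Arr) (v : Q.V) {x : GA k Q rel}
    (hx : x ∈ Submodule.span k (cycleWords k rel c)) :
    vtx k Q rel v * x ∈ Submodule.span k (cycleWords k rel c) := by
  refine mul_mem_of_mem_span ?_ hx
  rintro _ ⟨l, hne, hal, hlc, rfl⟩
  obtain ⟨b, l, rfl⟩ := List.exists_cons_of_ne_nil hne
  rw [wordEl_cons, ← mul_assoc]
  by_cases hvb : v = Q.src b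
  · rw [hvb, vtx_src_mul_arr, ← wordEl_cons]
    exact Submodule.subset_span ⟨_, hne, hal, hlc, rfl⟩
  · rw [vtx_mul_arr_of_ne hvb, zero_mul]
    exact zero_mem _

theorem cycleWords_mul_vtx (c : List Q.Arr) (v : Q.V) {x : GA k Q rel}
    (hx : x ∈ Submodule.span k (cycleWords k rel c)) :
    x * vtx k Q rel v ∈ Submodule.span k (cycleWords k rel c) := by
  refine mem_mul_of_mem_span ?_ hx
  rintro _ ⟨l, hne, hal, hlc, rfl⟩
  obtain ⟨l, b, rfl⟩ := (List.eq_nil_or_concat l).resolve_left hne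
  rw [List.concat_eq_append, wordEl_concat, mul_assoc]
  by_cases hvb : v = Q.tgt b
  · rw [hvb, arr_mul_vtx_tgt, ← wordEl_concat]
    exact Submodule.subset_span ⟨_, by simp, by simpa using hal, by simpa using hlc, rfl⟩
  · rw [arr_mul_vtx_of_ne hvb, mul_zero]
    exact zero_mem _

theorem PrimCycleSq.arr_mul_cycleWords (h : IsGentleRel Q rel) {c : List Q.Arr}
    (hc : PrimCycleSq rel c) (a : Q.Arr) {x : GA k Q rel}
    (hx : x ∈ Submodule.span k (cycleWords k rel c)) :
    arr k Q rel a * x ∈ Submodule.span k (cycleWords k rel c) := by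
  refine mul_mem_of_mem_span ?_ hx
  rintro _ ⟨l, hne, hal, hlc, rfl⟩
  obtain ⟨b, l, rfl⟩ := List.exists_cons_of_ne_nil hne
  by_cases hab : Follows rel a b
  · rw [← wordEl_cons]
    have hac := hc.mem_of_follows_left h hab (hlc b (by simp))
    exact Submodule.subset_span ⟨_, by simp, List.isChain_cons_cons.2 ⟨hab, hal⟩,
      List.forall_mem_cons.2 ⟨hac, hlc⟩, rfl⟩
  · rw [wordEl_cons, ← mul_assoc, arr_mul_arr_of_not_follows hab, zero_mul]
    exact zero_mem _

theorem PrimCycleSq.cycleWords_mul_arr (h : IsGentleRel Q rel) {c : List Q.Arr}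
    (hc : PrimCycleSq rel c) (b : Q.Arr) {x : GA k Q rel}
    (hx : x ∈ Submodule.span k (cycleWords k rel c)) :
    x * arr k Q rel b ∈ Submodule.span k (cycleWords k rel c) := by
  refine mem_mul_of_mem_span ?_ hx
  rintro _ ⟨l, hne, hal, hlc, rfl⟩
  obtain ⟨l, a, rfl⟩ := (List.eq_nil_or_concat l).resolve_left hne
  rw [List.concat_eq_append] at hal hlc ⊢
  by_cases hab : Follows rel a b
  · rw [← wordEl_concat]
    have hbc := hc.mem_of_follows h hab (hlc a (by simp))
    refine Submodule.subset_span ⟨_, by simp, List.IsChain.append hal (by simp) ?_, ?_, rfl⟩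
    · simpa [Follows] using hab
    · intro y hy
      rcases List.mem_append.1 hy with hy | hy
      · exact hlc y hy
      · rwa [List.mem_singleton.1 hy]
  · rw [wordEl_concat, mul_assoc, arr_mul_arr_of_not_follows hab, mul_zero]
    exact zero_mem _

theorem arr_mem_cycleWords {c : List Q.Arr} {a : Q.Arr} (ha : a ∈ c) :
    arr k Q rel a ∈ Submodule.span k (cycleWords k rel c) :=
  Submodule.subset_span ⟨[a], by simp, by simp [allowedWord_iff], by simpa using ha,
    by simp [wordEl]⟩

theorem PrimCycleSq.Jgamma_le (h : IsGentleRel Q rel) {c : List Q.Arr} (hc : PrimCycleSq rel c)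
    {y : GA k Q rel} (hy : y ∈ Jgamma k Q rel c) :
    y ∈ Submodule.span k (cycleWords k rel c) := by
  set N := Submodule.span k (cycleWords k rel c)
  let T : TwoSidedIdeal (GA k Q rel) := TwoSidedIdeal.mk' (N : Set (GA k Q rel)) N.zero_mem
    N.add_mem N.neg_mem
    (fun {z _} hx => mul_mem_of_generators_left
      (fun v _ hx => vtx_mul_cycleWords c v hx) (fun a _ hx => hc.arr_mul_cycleWords h a hx) z hx)
    (fun {_ z} hx => mul_mem_of_generators_right
      (fun v _ hx => cycleWords_mul_vtx c v hx) (fun a _ hx => hc.cycleWords_mul_arr h a hx) z hx)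
  have hmem : ∀ x, x ∈ T ↔ x ∈ N := fun x => TwoSidedIdeal.mem_mk' _ _ _ _ _ _ x
  have hle : Jgamma k Q rel c ≤ T := TwoSidedIdeal.span_le.2 (by
    rintro _ ⟨a, ha, rfl⟩
    exact (hmem _).2 (arr_mem_cycleWords ha))
  exact (hmem y).1 (hle hy)

variable (k Q rel) in
/-- The left annihilator of `J_γ` as a two-sided ideal. -/
def annIdeal (c : List Q.Arr) : TwoSidedIdeal (GA k Q rel) :=
  TwoSidedIdeal.mk' (annJ k Q rel c) (fun y _ => zero_mul y)
    (fun hx hy z hz => by rw [add_mul, hx z hz, hy z hz, add_zero])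
    (fun hx z hz => (neg_mul _ z).trans (by rw [hx z hz, neg_zero]))
    (fun hy z hz => by rw [mul_assoc, hy z hz, mul_zero])
    (fun hx z hz => by rw [mul_assoc, hx _ (TwoSidedIdeal.mul_mem_left _ _ _ hz)])

theorem coe_annIdeal (c : List Q.Arr) :
    (annIdeal k Q rel c : Set (GA k Q rel)) = annJ k Q rel c :=
  Set.ext fun x => TwoSidedIdeal.mem_mk' _ _ _ _ _ _ x

theorem mem_annJ_of_mul_arr (h : IsGentleRel Q rel) {c : List Q.Arr}
    (hc : PrimCycleSq rel c) {z : GA k Q rel} (hz : ∀ a ∈ c, z * arr k Q rel a = 0) :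
    z ∈ annJ k Q rel c := by
  intro y hy
  refine (Submodule.mem_bot k).1 (mul_mem_of_mem_span ?_ (hc.Jgamma_le h hy))
  rintro _ ⟨l, hne, -, hlc, rfl⟩
  obtain ⟨b, l, rfl⟩ := List.exists_cons_of_ne_nil hne
  rw [wordEl_cons, ← mul_assoc, hz b (hlc b (by simp)), zero_mul]
  exact zero_mem _

theorem PrimCycleSq.arr_mem_annJ (h : IsGentleRel Q rel) {c : List Q.Arr}
    (hc : PrimCycleSq rel c) {a : Q.Arr} (ha : a ∉ c) : arr k Q rel a ∈ annJ k Q rel c :=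
  mem_annJ_of_mul_arr h hc fun _ hb =>
    arr_mul_arr_of_not_follows fun hab => ha (hc.mem_of_follows_left h hab hb)

theorem PrimCycleSq.vtx_mem_annJ (h : IsGentleRel Q rel) {c : List Q.Arr}
    (hc : PrimCycleSq rel c) {v : Q.V} (hv : ∀ a ∈ c, v ≠ Q.src a) :
    vtx k Q rel v ∈ annJ k Q rel c :=
  mem_annJ_of_mul_arr h hc fun a ha => vtx_mul_arr_of_ne (hv a ha)

theorem vtx_mul_cycleVtxs (c : List Q.Arr) (v : Q.V) {x : GA k Q rel}
    (hx : x ∈ cycleVtxs k rel c) :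
    vtx k Q rel v * x ∈ Submodule.span k (cycleVtxs k rel c) := by
  obtain ⟨b, hb, rfl⟩ := hx
  by_cases hvb : v = Q.src b
  · rw [hvb, vtx_mul_self]
    exact Submodule.subset_span ⟨b, hb, rfl⟩
  · rw [vtx_mul_of_ne hvb]
    exact zero_mem _

theorem PrimCycleSq.span_sup_annJ (h : IsGentleRel Q rel) {c : List Q.Arr}
    (hc : PrimCycleSq rel c) :
    Submodule.span k (cycleVtxs k rel c ∪ cycleWords k rel c) ⊔
      Submodule.span k (annJ k Q rel c) = ⊤ := by
  set S := Submodule.span k (cycleVtxs k rel c ∪ cycleWords k rel c) ⊔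
      Submodule.span k (annJ k Q rel c)
  have hV : Submodule.span k (cycleVtxs k rel c) ≤ S :=
    (Submodule.span_mono Set.subset_union_left).trans le_sup_left
  have hN : Submodule.span k (cycleWords k rel c) ≤ S :=
    (Submodule.span_mono Set.subset_union_right).trans le_sup_left
  have hA : ∀ x ∈ annJ k Q rel c, x ∈ S := fun x hx =>
    (le_sup_right : _ ≤ S) (Submodule.subset_span hx)
  have hmul : ∀ z, (∀ x ∈ cycleVtxs k rel c, z * x ∈ S) →
      (∀ x ∈ cycleWords k rel c, z * x ∈ S) → ∀ x ∈ S, z * x ∈ S := by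
    intro z h1 h2 x hx
    rw [show S = _ from (Submodule.span_union _ _).symm] at hx
    refine mul_mem_of_mem_span ?_ hx
    rintro x ((hx | hx) | hx)
    · exact h1 x hx
    · exact h2 x hx
    · refine hA _ ?_
      rw [← coe_annIdeal] at hx ⊢
      exact TwoSidedIdeal.mul_mem_left _ _ _ hx
  have hone : (1 : GA k Q rel) ∈ S := by
    rw [← sum_vtx]
    refine S.sum_mem fun v _ => ?_
    by_cases hv : ∃ a ∈ c, v = Q.src a
    · obtain ⟨a, ha, rfl⟩ := hv
      exact hV (Submodule.subset_span ⟨a, ha, rfl⟩)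
    · exact hA _ (hc.vtx_mem_annJ h (by simpa using hv))
  refine (Submodule.eq_top_iff').2 fun z => ?_
  rw [← mul_one z]
  refine mul_mem_of_generators_left (fun v => hmul _ ?_ ?_) (fun a => hmul _ ?_ ?_) z hone
  · exact fun x hx => hV (vtx_mul_cycleVtxs c v hx)
  · exact fun x hx => hN (vtx_mul_cycleWords c v (Submodule.subset_span hx))
  · rintro _ ⟨b, -, rfl⟩
    by_cases hab : Q.src b = Q.tgt a
    · rw [hab, arr_mul_vtx_tgt]
      by_cases ha : a ∈ c
      · exact hN (arr_mem_cycleWords ha)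
      · exact hA _ (hc.arr_mem_annJ h ha)
    · rw [arr_mul_vtx_of_ne hab]
      exact zero_mem _
  · exact fun x hx => hN (hc.arr_mul_cycleWords h a (Submodule.subset_span hx))

theorem PrimCycleSq.mul_mem_span (h : IsGentleRel Q rel) {c : List Q.Arr}
    (hc : PrimCycleSq rel c) {x y : GA k Q rel}
    (hx : x ∈ Submodule.span k (cycleVtxs k rel c ∪ cycleWords k rel c))
    (hy : y ∈ Submodule.span k (cycleVtxs k rel c ∪ cycleWords k rel c)) :
    x * y ∈ Submodule.span k (cycleVtxs k rel c ∪ cycleWords k rel c) := by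
  have hV := Submodule.span_mono (R := k)
    (Set.subset_union_left (s := cycleVtxs k rel c) (t := cycleWords k rel c))
  have hN := Submodule.span_mono (R := k)
    (Set.subset_union_right (s := cycleVtxs k rel c) (t := cycleWords k rel c))
  refine mul_mem_of_mem_span (fun y hy => mem_mul_of_mem_span (fun x hx => ?_) hx) hy
  rcases hy with hy | hy
  · rcases hx with ⟨a, -, rfl⟩ | hx
    · exact hV (vtx_mul_cycleVtxs c _ hy)
    · obtain ⟨b, -, rfl⟩ := hy
      exact hN (cycleWords_mul_vtx c _ (Submodule.subset_span hx))
  · exact hN (mul_mem_of_generators_left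
      (fun v _ hx => vtx_mul_cycleWords c v hx) (fun a _ hx => hc.arr_mul_cycleWords h a hx) x
      (Submodule.subset_span hy))

end Algebra

section Representation

open Polynomial

variable {k : Type} [Field k] {Q : Quiv} {rel : Q.Arr → Q.Arr → Prop}

variable (k Q) in
/-- The action of a stationary path on the string module of `γ`. -/
def stringVtx (v : Q.V) : Module.End k[X] (Q.Arr → k[X]) :=
  LinearMap.pi fun b => if Q.src b = v then LinearMap.proj b else 0

variable (k rel) in
/-- The action of an arrow on the string module of `γ`. -/
def stringArr (c : List Q.Arr) (a : Q.Arr) : Module.End k[X] (Q.Arr → k[X]) :=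
  LinearMap.pi fun b => if b = a ∧ a ∈ c then (X : k[X]) • LinearMap.proj (nextArr rel a) else 0

theorem stringVtx_apply (v : Q.V) (f : Q.Arr → k[X]) (b : Q.Arr) :
    stringVtx k Q v f b = if Q.src b = v then f b else 0 := by
  rw [stringVtx, LinearMap.pi_apply]
  split_ifs <;> simp

theorem stringArr_apply (c : List Q.Arr) (a : Q.Arr) (f : Q.Arr → k[X]) (b : Q.Arr) :
    stringArr k rel c a f b = if b = a ∧ a ∈ c then X * f (nextArr rel a) else 0 := by
  rw [stringArr, LinearMap.pi_apply]
  split_ifs <;> simp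

variable (k rel) in
/-- The representation of the free algebra on the string module of `γ`. -/
def stringRepAux (c : List Q.Arr) :
    FreeAlgebra k (Q.V ⊕ Q.Arr) →ₐ[k] Module.End k[X] (Q.Arr → k[X]) :=
  FreeAlgebra.lift k (Sum.elim (stringVtx k Q) (stringArr k rel c))

theorem PrimCycleSq.stringRepAux_rel (h : IsGentleRel Q rel) {c : List Q.Arr}
    (hc : PrimCycleSq rel c) ⦃x y : FreeAlgebra k (Q.V ⊕ Q.Arr)⦄ (hxy : GARel k Q rel x y) :
    stringRepAux k rel c x = stringRepAux k rel c y := by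
  refine LinearMap.ext fun f => funext fun b => ?_
  cases hxy with
  | idem v =>
    simp only [stringRepAux, map_mul, FreeAlgebra.lift_ι_apply, Sum.elim_inl,
      Module.End.mul_apply, stringVtx_apply]
    grind
  | orth v w hvw =>
    simp only [stringRepAux, map_mul, FreeAlgebra.lift_ι_apply, Sum.elim_inl,
      Module.End.mul_apply, stringVtx_apply, map_zero, LinearMap.zero_apply, Pi.zero_apply]
    grind
  | unit => simp [stringRepAux, stringVtx_apply]
  | src_mul a =>
    simp only [stringRepAux, map_mul, FreeAlgebra.lift_ι_apply, Sum.elim_inl, Sum.elim_inr,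
      Module.End.mul_apply, stringVtx_apply, stringArr_apply]
    grind
  | mul_tgt a =>
    simp only [stringRepAux, map_mul, FreeAlgebra.lift_ι_apply, Sum.elim_inl, Sum.elim_inr,
      Module.End.mul_apply, stringVtx_apply, stringArr_apply]
    by_cases ha : a ∈ c
    · rw [if_pos (hc.follows_nextArr h ha).1.symm]
    · simp [ha]
  | src_zero v a hv =>
    simp only [stringRepAux, map_mul, FreeAlgebra.lift_ι_apply, Sum.elim_inl, Sum.elim_inr,
      Module.End.mul_apply, stringVtx_apply, stringArr_apply, map_zero, LinearMap.zero_apply,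
      Pi.zero_apply]
    grind
  | tgt_zero v a hv =>
    simp only [stringRepAux, map_mul, FreeAlgebra.lift_ι_apply, Sum.elim_inl, Sum.elim_inr,
      Module.End.mul_apply, stringVtx_apply, stringArr_apply, map_zero, LinearMap.zero_apply,
      Pi.zero_apply]
    by_cases ha : a ∈ c
    · rw [if_neg (c := Q.src (nextArr rel a) = v) fun hn =>
        hv (hn.symm.trans (hc.follows_nextArr h ha).1.symm)]
      simp
    · simp [ha]
  | rel_zero a b' hab =>
    simp only [stringRepAux, map_mul, FreeAlgebra.lift_ι_apply, Sum.elim_inr,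
      Module.End.mul_apply, stringArr_apply, map_zero, LinearMap.zero_apply, Pi.zero_apply]
    by_cases ha : a ∈ c
    · rw [if_neg (c := nextArr rel a = b' ∧ b' ∈ c) fun hn =>
        (hc.follows_nextArr h ha).2 (hn.1 ▸ hab)]
      simp
    · simp [ha]

variable (k) in
/-- The string module of `γ`, as a representation of `A` over `k[X]`. -/
def stringRep (h : IsGentleRel Q rel) {c : List Q.Arr} (hc : PrimCycleSq rel c) :
    GA k Q rel →ₐ[k] Module.End k[X] (Q.Arr → k[X]) :=
  RingQuot.liftAlgHom k ⟨stringRepAux k rel c, hc.stringRepAux_rel h⟩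

theorem stringRep_vtx (h : IsGentleRel Q rel) {c : List Q.Arr} (hc : PrimCycleSq rel c)
    (v : Q.V) : stringRep k h hc (vtx k Q rel v) = stringVtx k Q v := by
  simp [stringRep, vtx, stringRepAux]

theorem stringRep_arr (h : IsGentleRel Q rel) {c : List Q.Arr} (hc : PrimCycleSq rel c)
    (a : Q.Arr) : stringRep k h hc (arr k Q rel a) = stringArr k rel c a := by
  simp [stringRep, arr, stringRepAux]

variable (k) in
/-- The indicator function of the arrows of `c`. -/
def cycleIndicator (c : List Q.Arr) : Q.Arr → k[X] := fun b => if b ∈ c then 1 else 0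

theorem stringRep_wordEl (h : IsGentleRel Q rel) {c : List Q.Arr} (hc : PrimCycleSq rel c)
    {a : Q.Arr} {l : List Q.Arr} (hl : AllowedWord rel (a :: l)) (hlc : ∀ b ∈ a :: l, b ∈ c) :
    stringRep k h hc (wordEl k Q rel (a :: l)) (cycleIndicator k c) =
      Pi.single a (X ^ (l.length + 1)) := by
  induction l generalizing a with
  | nil =>
    have ha : a ∈ c := hlc a (by simp)
    ext1 b
    have hn := hc.nextArr_mem h ha
    simp [wordEl, stringRep_arr, stringArr_apply, cycleIndicator, ha, hn, Pi.single_apply]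
  | cons b l ih =>
    obtain ⟨hab, hl⟩ := List.isChain_cons_cons.1 (allowedWord_iff.1 hl)
    obtain ⟨ha, hlc⟩ := List.forall_mem_cons.1 hlc
    ext1 d
    rw [wordEl_cons, map_mul, Module.End.mul_apply, ih hl hlc, stringRep_arr, stringArr_apply,
      h.nextArr_eq hab]
    simp [ha, Pi.single_apply, pow_succ']

variable (k rel) in
/-- The linear map recovering an element of the span of the paths in the arrows of `c` from its
action on `cycleIndicator k c`. -/
def cycleRecover (c : List Q.Arr) : (Q.Arr → k[X]) →ₗ[k] GA k Q rel :=
  open Classical in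
  (∑ v : Q.V, if h : ∃ a ∈ c, Q.src a = v then
    (LinearMap.toSpanSingleton k _ (vtx k Q rel v)) ∘ₗ lcoeff k 0 ∘ₗ LinearMap.proj h.choose
    else 0) +
  ∑ a : Q.Arr, Polynomial.lsum (fun n => if n = 0 then 0 else
    LinearMap.toSpanSingleton k _ (wordEl k Q rel (List.iterate (nextArr rel) a n))) ∘ₗ
    LinearMap.proj a

theorem cycleRecover_stringRep_wordEl (h : IsGentleRel Q rel) {c : List Q.Arr}
    (hc : PrimCycleSq rel c) {a : Q.Arr} {l : List Q.Arr} (hl : AllowedWord rel (a :: l))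
    (hlc : ∀ b ∈ a :: l, b ∈ c) :
    cycleRecover k rel c (stringRep k h hc (wordEl k Q rel (a :: l)) (cycleIndicator k c)) =
      wordEl k Q rel (a :: l) := by
  rw [stringRep_wordEl h hc hl hlc, cycleRecover, LinearMap.add_apply, LinearMap.sum_apply,
    LinearMap.sum_apply, Finset.sum_eq_zero, zero_add, Finset.sum_eq_single a]
  · rw [LinearMap.comp_apply, LinearMap.proj_apply, Pi.single_eq_same, ← monomial_one_right_eq_X_pow,
      Polynomial.lsum_apply, Polynomial.sum_monomial_index _ _ (by simp)]
    rw [if_neg (by simp), ← h.eq_iterate hl, LinearMap.toSpanSingleton_apply, one_smul]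
  · intro b _ hb
    rw [LinearMap.comp_apply, LinearMap.proj_apply, Pi.single_eq_of_ne hb, map_zero]
  · simp
  · intro v _
    split_ifs with hv
    · simp only [LinearMap.comp_apply, LinearMap.proj_apply, lcoeff_apply, Pi.single_apply]
      split_ifs <;> simp
    · rfl

theorem cycleRecover_stringRep_vtx (h : IsGentleRel Q rel) {c : List Q.Arr}
    (hc : PrimCycleSq rel c) {a : Q.Arr} (ha : a ∈ c) :
    cycleRecover k rel c (stringRep k h hc (vtx k Q rel (Q.src a)) (cycleIndicator k c)) =
      vtx k Q rel (Q.src a) := by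
  rw [stringRep_vtx, cycleRecover, LinearMap.add_apply, LinearMap.sum_apply,
    LinearMap.sum_apply, Finset.sum_eq_single (Q.src a), Finset.sum_eq_zero, add_zero]
  · have hv : ∃ b ∈ c, Q.src b = Q.src a := ⟨a, ha, rfl⟩
    rw [dif_pos hv]
    simp [stringVtx_apply, cycleIndicator, hv.choose_spec.1, hv.choose_spec.2]
  · intro b _
    rw [LinearMap.comp_apply, LinearMap.proj_apply, stringVtx_apply, cycleIndicator,
      Polynomial.lsum_apply]
    split_ifs
    · rw [← Polynomial.C_1, Polynomial.sum_C_index (by simp)]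
      simp
    · simp
    · simp
  · intro v _ hne
    split_ifs with hv
    · have hs : Q.src hv.choose ≠ Q.src a := by rwa [hv.choose_spec.2]
      simp [stringVtx_apply, hs]
    · rfl
  · simp

theorem cycleRecover_stringRep (h : IsGentleRel Q rel) {c : List Q.Arr}
    (hc : PrimCycleSq rel c) {x : GA k Q rel}
    (hx : x ∈ Submodule.span k (cycleVtxs k rel c ∪ cycleWords k rel c)) :
    cycleRecover k rel c (stringRep k h hc x (cycleIndicator k c)) = x := by
  induction hx using Submodule.span_induction with
  | mem x hx =>
    rcases hx with ⟨a, ha, rfl⟩ | ⟨l, hne, hal, hlc, rfl⟩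
    · exact cycleRecover_stringRep_vtx h hc ha
    · obtain ⟨b, l, rfl⟩ := List.exists_cons_of_ne_nil hne
      exact cycleRecover_stringRep_wordEl h hc hal hlc
  | zero => simp
  | add x y _ _ hx hy => rw [map_add, LinearMap.add_apply, map_add, hx, hy]
  | smul r x _ hx => rw [map_smul, LinearMap.smul_apply, map_smul, hx]

theorem stringRep_sum_arr (h : IsGentleRel Q rel) {c : List Q.Arr} (hc : PrimCycleSq rel c) :
    stringRep k h hc (∑ a ∈ c.toFinset, arr k Q rel a) (cycleIndicator k c) =
      (X : k[X]) • cycleIndicator k c := by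
  ext1 b
  rw [map_sum, LinearMap.sum_apply, Finset.sum_apply]
  simp only [stringRep_arr, stringArr_apply, Pi.smul_apply, smul_eq_mul]
  by_cases hb : b ∈ c
  · rw [Finset.sum_eq_single b (fun a _ hab => if_neg fun hn => hab hn.1.symm) (by simp [hb])]
    simp [hb, cycleIndicator, hc.nextArr_mem h hb]
  · rw [Finset.sum_eq_zero fun a _ => if_neg fun hn : b = a ∧ a ∈ c => hb (hn.1 ▸ hn.2)]
    simp [cycleIndicator, hb]

theorem PrimCycleSq.eq_zero_of_mem_annJ (h : IsGentleRel Q rel) {c : List Q.Arr}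
    (hc : PrimCycleSq rel c) {x : GA k Q rel}
    (hx : x ∈ Submodule.span k (cycleVtxs k rel c ∪ cycleWords k rel c))
    (hann : x ∈ annJ k Q rel c) : x = 0 := by
  have hJ : ∑ a ∈ c.toFinset, arr k Q rel a ∈ Jgamma k Q rel c :=
    sum_mem fun a ha => TwoSidedIdeal.subset_span ⟨a, by simpa using ha, rfl⟩
  have h0 : (X : k[X]) • stringRep k h hc x (cycleIndicator k c) = 0 := by
    rw [← map_smul, ← stringRep_sum_arr h hc, ← Module.End.mul_apply, ← map_mul, hann _ hJ,
      map_zero, LinearMap.zero_apply]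
  have h1 : stringRep k h hc x (cycleIndicator k c) = 0 :=
    (smul_eq_zero.1 h0).resolve_left X_ne_zero
  rw [← cycleRecover_stringRep h hc hx, h1, map_zero]

end Representation

/-- **Corollary 3.3 (cor:annihilator).** Let `A = kQ/I` be a (locally) gentle algebra with
an infinite maximal path `γ = c^∞`.  Then the left annihilator `ann_A(J_γ)` is a two-sided
ideal of `A` and `A = A' ⊕ ann_A(J_γ)`, where `A'` is the locally gentle subalgebra of `A`
spanned by the paths of the minimal subquiver `Q'` of `Q` containing `γ` (the arrows `α`
with `γ_α = γ` and their endpoints), and `A'` has `γ` as its unique maximal path. -/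
theorem statement7 (k : Type) [Field k] [CharZero k] (Q : Quiv)
    (rel : Q.Arr → Q.Arr → Prop) (hgentle : IsGentleRel Q rel)
    (c : List Q.Arr) (hc : PrimCycleSq rel c) :
    -- `ann_A(J_γ)` is a two-sided ideal
    (∃ T : TwoSidedIdeal (GA k Q rel), (T : Set (GA k Q rel)) = annJ k Q rel c) ∧
    -- `A = A' ⊕ ann_A(J_γ)`, with `A'` the span of the paths lying on `Q'`
    (fun (A' : Submodule k (GA k Q rel)) =>
      IsCompl A' (Submodule.span k (annJ k Q rel c)) ∧
      -- `A'` is a (non-unital) subalgebra of `A`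
      (∀ x ∈ A', ∀ y ∈ A', x * y ∈ A') ∧
      -- `A'` is locally gentle with `γ` as its unique maximal path: no finite maximal
      -- path of `A` lies in `Q'`, and every primitive cycle of `Q'` with nonvanishing
      -- square is a rotation of `c`
      (∀ l : List Q.Arr, FiniteMaxWord rel l → ∃ a ∈ l, a ∉ c) ∧
      (∀ l : List Q.Arr, PrimCycleSq rel l → (∀ a ∈ l, a ∈ c) → ∃ n : ℕ, l = c.rotate n))
      (Submodule.span k
        ({x | ∃ a ∈ c, x = vtx k Q rel (Q.src a)} ∪
         {x | ∃ l : List Q.Arr, l ≠ [] ∧ AllowedWord rel l ∧ (∀ a ∈ l, a ∈ c) ∧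
            x = wordEl k Q rel l})) := by
  refine ⟨⟨annIdeal k Q rel c, coe_annIdeal c⟩, ⟨?_, ?_⟩, ?_, ?_, ?_⟩
  · rw [Submodule.disjoint_def]
    intro x hx hann
    refine hc.eq_zero_of_mem_annJ hgentle hx fun y hy => ?_
    exact (Submodule.mem_bot k).1
      (mem_mul_of_mem_span (X := annJ k Q rel c)
        (fun z hz => (Submodule.mem_bot k).2 (hz y hy)) hann)
  · exact codisjoint_iff.2 (hc.span_sup_annJ hgentle)
  · exact fun x hx y hy => hc.mul_mem_span hgentle hx hy
  · exact fun l hl => hc.not_finiteMaxWord hgentle hl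
  · exact fun l hl hlc => hc.eq_rotate hgentle hl hlc

end LocGentle
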